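/- The conjugacy class of the 5-cycle (1 2 3 4 5) in the alternating group A₅, equipped with the conjugation operation a ◃ b = b⁻¹ab, is a simple quandle with exactly 12 elements, yet the conjugation action of A₅ on this class is transitive but not primitive. -/

import Mathlib

universe u v

/-- A quandle: a set with a binary operation `◃` such that every right
translation `x ↦ x ◃ a` is bijective, the operation is right self-distributive,
and every element is idempotent. -/
class Quandle' (Q : Type u) where
  act : Q → Q → Q
  act_bijective : ∀ a : Q, Function.Bijective fun x => act x a
  act_distrib : ∀ a b c : Q, act (act a b) c = act (act a c) (act b c)
  act_self : ∀ a : Q, act a a = a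

infixl:65 " ◃ " => Quandle'.act

namespace Quandle'

/-- The right translation by `a`, as a permutation of the quandle. -/
noncomputable def rho {Q : Type u} [Quandle' Q] (a : Q) : Equiv.Perm Q :=
  Equiv.ofBijective _ (act_bijective a)

/-- The inner automorphism group of a quandle: the subgroup of the symmetric
group generated by the right translations. -/
noncomputable def Inn (Q : Type u) [Quandle' Q] : Subgroup (Equiv.Perm Q) :=
  Subgroup.closure (Set.range (rho : Q → Equiv.Perm Q))

/-- A quandle is connected if its inner automorphism group acts transitively. -/
def IsConnected (Q : Type u) [Quandle' Q] : Prop :=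
  ∀ x y : Q, ∃ g ∈ Inn Q, g x = y

/-- Quandle homomorphisms. -/
def IsHom {Q : Type u} {R : Type v} [Quandle' Q] [Quandle' R] (f : Q → R) : Prop :=
  ∀ a b : Q, f (a ◃ b) = f a ◃ f b

/-- A quandle is simple if it has more than one element and every quandle
homomorphism out of it is either injective or constant. -/
def IsSimple (Q : Type u) [Quandle' Q] : Prop :=
  Nontrivial Q ∧ ∀ (R : Type u) [Quandle' R] (f : Q → R), IsHom f →
    Function.Injective f ∨ ∀ a b : Q, f a = f b

/-- A block for the action of the inner automorphism group. -/
noncomputable def IsBlock (Q : Type u) [Quandle' Q] (B : Set Q) : Prop :=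
  ∀ g ∈ Inn Q, ⇑g '' B = B ∨ Disjoint (⇑g '' B) B

/-- A connected quandle is primitive if the action of its inner automorphism
group preserves no nontrivial partition into blocks. -/
noncomputable def IsPrimitive (Q : Type u) [Quandle' Q] : Prop :=
  IsConnected Q ∧ ∀ B : Set Q, IsBlock Q B → B.Subsingleton ∨ B = Set.univ

end Quandle'

open Quandle'

/-- The conjugacy class of transpositions in the symmetric group `S₅`. -/
abbrev Transposition5 : Type := {σ : Equiv.Perm (Fin 5) // σ.IsSwap}

/-- The conjugation quandle structure `a ◃ b = b⁻¹ * a * b` on the class of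
transpositions of `S₅`. -/
instance : Quandle' Transposition5 where
  act a b := ⟨b.1⁻¹ * a.1 * b.1, by
    obtain ⟨x, y, hxy, ha⟩ := a.2
    refine ⟨b.1⁻¹ x, b.1⁻¹ y, fun h => hxy (b.1⁻¹.injective h), ?_⟩
    rw [ha, Equiv.swap_apply_apply]
    group⟩
  act_bijective a := by
    constructor
    · intro x y h
      have := Subtype.ext_iff.mp h
      simp only [mul_left_cancel_iff, mul_right_cancel_iff] at this
      exact Subtype.ext this
    · intro y
      refine ⟨⟨a.1 * y.1 * a.1⁻¹, ?_⟩, Subtype.ext (by group)⟩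
      obtain ⟨x, z, hxz, hy⟩ := y.2
      refine ⟨a.1 x, a.1 z, fun h => hxz (a.1.injective h), ?_⟩
      rw [hy, Equiv.swap_apply_apply]
  act_distrib a b c := Subtype.ext (by simp only []; group)
  act_self a := Subtype.ext (by simp only []; group)

/-- The alternating group of degree `5`. -/
abbrev A5 : Type := alternatingGroup (Fin 5)

/-- The `5`-cycle `(1 2 3 4 5)` as an element of `A₅`. -/
def c5 : A5 := ⟨finRotate 5, Equiv.Perm.mem_alternatingGroup.mpr (by decide)⟩

/-- The conjugacy class of the `5`-cycle `(1 2 3 4 5)` in `A₅`. -/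
abbrev C5 : Type := {x : A5 // IsConj c5 x}

/-- The conjugation quandle structure `a ◃ b = b⁻¹ * a * b` on this class. -/
instance : Quandle' C5 where
  act a b := ⟨b.1⁻¹ * a.1 * b.1, a.2.trans (isConj_iff.mpr ⟨b.1⁻¹, by group⟩)⟩
  act_bijective a := by
    constructor
    · intro x y h
      have := Subtype.ext_iff.mp h
      simp only [mul_left_cancel_iff, mul_right_cancel_iff] at this
      exact Subtype.ext this
    · intro y
      exact ⟨⟨a.1 * y.1 * a.1⁻¹, y.2.trans (isConj_iff.mpr ⟨a.1, by group⟩)⟩,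
        Subtype.ext (by group)⟩
  act_distrib a b c := Subtype.ext (by simp only []; group)
  act_self a := Subtype.ext (by simp only []; group)

/-- The conjugation action of `A₅` on the conjugacy class of `(1 2 3 4 5)`. -/
def conjAct5 (g : A5) (x : C5) : C5 :=
  ⟨g * x.1 * g⁻¹, x.2.trans (isConj_iff.mpr ⟨g, rfl⟩)⟩

/-- A simple group is generated by the conjugacy class of any nontrivial element. -/
theorem closure_isConj_eq_top {G : Type*} [Group G] [IsSimpleGroup G] {c : G} (hc : c ≠ 1) :
    Subgroup.closure {x : G | IsConj c x} = ⊤ := by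
  have h : Subgroup.normalClosure {c} = ⊤ := by
    refine (Subgroup.normalClosure_normal (s := {c})).eq_bot_or_eq_top.resolve_left fun h => hc ?_
    simpa [h] using Subgroup.subset_normalClosure (Set.mem_singleton c)
  rw [← h, Subgroup.normalClosure, Group.conjugatesOfSet]
  simp [conjugatesOf]

/-- The equivalence relation induced by a quandle homomorphism out of the class of `c5` is
invariant under conjugation. -/
theorem Quandle'.IsHom.conjAct5_eq_iff {R : Type*} [Quandle' R] {f : C5 → R} (hf : IsHom f)
    (h5 : Subgroup.closure {x : A5 | IsConj c5 x} = ⊤) (g : A5) (x y : C5) :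
    f (conjAct5 g x) = f (conjAct5 g y) ↔ f x = f y := by
  have hg : g ∈ Subgroup.closure {x : A5 | IsConj c5 x} := h5 ▸ Subgroup.mem_top g
  induction hg using Subgroup.closure_induction generalizing x y with
  | mem b hb =>
    have key (z : C5) : f z = f (conjAct5 b z) ◃ f ⟨b, hb⟩ := by
      rw [← hf]
      exact congrArg f (Subtype.ext (by simp [Quandle'.act, conjAct5, mul_assoc]))
    rw [key x, key y]
    exact (act_bijective (f ⟨b, hb⟩)).injective.eq_iff.symm
  | one => simp [conjAct5]
  | mul a b _ _ iha ihb =>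
    have hmul (z : C5) : conjAct5 (a * b) z = conjAct5 a (conjAct5 b z) :=
      Subtype.ext (by simp [conjAct5, mul_assoc])
    rw [hmul, hmul]
    exact (iha _ _).trans (ihb x y)
  | inv a _ iha =>
    have hinv (z : C5) : conjAct5 a (conjAct5 a⁻¹ z) = z :=
      Subtype.ext (by simp [conjAct5, mul_assoc])
    simpa only [hinv] using (iha (conjAct5 a⁻¹ x) (conjAct5 a⁻¹ y)).symm

theorem conjAct5_transitive (x y : C5) : ∃ g : A5, conjAct5 g x = y := by
  obtain ⟨g, hg⟩ := isConj_iff.mp (x.2.symm.trans y.2)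
  exact ⟨g, Subtype.ext hg⟩

theorem c5_ne_one : c5 ≠ 1 := by decide

theorem c5_ne_inv : c5 ≠ c5⁻¹ := by decide

/-- `c5` is conjugate to its inverse in `A₅`, by the reversal of `Fin 5`. -/
theorem isConj_c5_inv : IsConj c5 c5⁻¹ :=
  isConj_iff.mpr ⟨⟨Fin.revPerm, Equiv.Perm.mem_alternatingGroup.mpr (by decide)⟩, by decide⟩

/-- The elements of `A₅` whose conjugation action preserves every fibre of a map
out of the class of `c5`. -/
def fibreKernel {R : Type*} (f : C5 → R) : Subgroup A5 where
  carrier := {g | ∀ x, f (conjAct5 g x) = f x}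
  one_mem' x := by simp [conjAct5]
  mul_mem' {a b} ha hb x := by
    rw [← hb x, ← ha (conjAct5 b x)]
    exact congrArg f (Subtype.ext (by simp [conjAct5, mul_assoc]))
  inv_mem' {a} ha x := by
    rw [← ha (conjAct5 a⁻¹ x)]
    exact congrArg f (Subtype.ext (by simp [conjAct5, mul_assoc]))

theorem Quandle'.IsHom.fibreKernel_normal {R : Type*} [Quandle' R] {f : C5 → R} (hf : IsHom f)
    (h5 : Subgroup.closure {x : A5 | IsConj c5 x} = ⊤) : (fibreKernel f).Normal where
  conj_mem n hn g x := by
    have h := (hf.conjAct5_eq_iff h5 g _ _).mpr (hn (conjAct5 g⁻¹ x))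
    convert h using 2 <;> exact Subtype.ext (by simp [conjAct5, mul_assoc])

theorem Quandle'.IsHom.inv_mul_mem_fibreKernel {R : Type*} [Quandle' R] {f : C5 → R} (hf : IsHom f)
    {a b : C5} (hab : f a = f b) : a.1⁻¹ * b.1 ∈ fibreKernel f := by
  intro x
  have h : f (conjAct5 b.1 x ◃ a) = f (conjAct5 b.1 x ◃ b) := by rw [hf, hf, hab]
  convert h using 2 <;> exact Subtype.ext (by simp [Quandle'.act, conjAct5, mul_assoc])

theorem isSimple_C5 : IsSimple C5 := by
  have : IsSimpleGroup A5 := alternatingGroup.isSimpleGroup (by simp)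
  have h5 := closure_isConj_eq_top c5_ne_one
  refine ⟨⟨⟨c5, .refl _⟩, ⟨c5⁻¹, isConj_c5_inv⟩, fun h => c5_ne_inv (congrArg Subtype.val h)⟩, ?_⟩
  intro R _ f hf
  rcases (hf.fibreKernel_normal h5).eq_bot_or_eq_top with h | h
  · refine .inl fun a b hab => Subtype.ext ?_
    have hmem := hf.inv_mul_mem_fibreKernel hab
    rwa [h, Subgroup.mem_bot, inv_mul_eq_one] at hmem
  · refine .inr fun a b => ?_
    obtain ⟨g, rfl⟩ := conjAct5_transitive a b
    have hg : g ∈ fibreKernel f := h ▸ Subgroup.mem_top g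
    exact (hg a).symm

theorem card_C5 : Nat.card C5 = 12 := by
  have h : {x : A5 | IsConj c5 x} = ↑(Finset.univ.image fun g : A5 => g * c5 * g⁻¹) := by
    ext x
    simp [isConj_iff]
  have h12 : (Finset.univ.image fun g : A5 => g * c5 * g⁻¹).card = 12 := by decide +kernel
  rw [← h12, ← Set.ncard_coe_finset, ← h]
  rfl

/-- The block of the conjugation action formed by `c5` and its inverse. -/
def inversePair : Set C5 := {x | x.1 = c5 ∨ x.1 = c5⁻¹}

theorem mem_image_inversePair (g : A5) (x : C5) :
    x ∈ conjAct5 g '' inversePair ↔ x.1 = g * c5 * g⁻¹ ∨ x.1 = (g * c5 * g⁻¹)⁻¹ := by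
  have hinv : (g * c5 * g⁻¹)⁻¹ = g * c5⁻¹ * g⁻¹ := by group
  rw [hinv]
  constructor
  · rintro ⟨y, hy | hy, rfl⟩ <;> simp [conjAct5, hy]
  · intro hx
    refine ⟨conjAct5 g⁻¹ x, ?_, Subtype.ext (by simp [conjAct5, mul_assoc])⟩
    rcases hx with hx | hx <;> simp [inversePair, conjAct5, hx, mul_assoc]

theorem inversePair_isBlock (g : A5) :
    conjAct5 g '' inversePair = inversePair ∨ Disjoint (conjAct5 g '' inversePair) inversePair := by
  by_cases hg : g * c5 * g⁻¹ = c5 ∨ g * c5 * g⁻¹ = c5⁻¹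
  · left
    ext x
    rw [mem_image_inversePair]
    rcases hg with hg | hg <;> simp [hg, inversePair, or_comm]
  · refine .inr (Set.disjoint_left.mpr fun x hx hx' => hg ?_)
    rw [mem_image_inversePair] at hx
    rcases hx with hx | hx
    · rwa [← hx]
    · rw [← inv_inv (g * c5 * g⁻¹), ← hx, inv_inj, inv_eq_iff_eq_inv, or_comm]
      exact hx'

theorem not_primitive_conjAct5 :
    ¬ (∀ B : Set C5, (∀ g : A5, conjAct5 g '' B = B ∨ Disjoint (conjAct5 g '' B) B) →
      B.Subsingleton ∨ B = Set.univ) := by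
  intro h
  let a : C5 := ⟨c5, .refl _⟩
  let b : C5 := ⟨c5⁻¹, isConj_c5_inv⟩
  have hab : a ≠ b := fun h => c5_ne_inv (congrArg Subtype.val h)
  rcases h inversePair inversePair_isBlock with h | h
  · exact hab (h (.inl rfl) (.inr rfl))
  · have hpair : inversePair = {a, b} :=
      Set.ext fun x => or_congr (Subtype.ext_iff (a2 := a)).symm (Subtype.ext_iff (a2 := b)).symm
    have hcard := Set.ncard_univ C5
    rw [← h, hpair, card_C5, Set.ncard_pair hab] at hcard
    omega

/-- The conjugacy class of the `5`-cycle `(1 2 3 4 5)` in `A₅`, under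
conjugation `a ◃ b = b⁻¹ * a * b`, is a simple quandle with exactly `12`
elements, yet the conjugation action of `A₅` on it, while transitive, is not
primitive. -/
theorem five_cycle_class_A5_simple_not_primitive :
    IsSimple C5 ∧ Nat.card C5 = 12 ∧
      (∀ x y : C5, ∃ g : A5, conjAct5 g x = y) ∧
      ¬ (∀ B : Set C5, (∀ g : A5, conjAct5 g '' B = B ∨ Disjoint (conjAct5 g '' B) B) →
          B.Subsingleton ∨ B = Set.univ) :=
  ⟨isSimple_C5, card_C5, conjAct5_transitive, not_primitive_conjAct5⟩
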